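/- There is no distance-regular graph with intersection array {55, 36, 11; 1, 4, 45}. -/

import Mathlib

open SimpleGraph Finset

/-- `G` is distance-regular with intersection numbers `b i`, `c i`. -/
def IsDRG {V : Type*} [Fintype V] [DecidableEq V] (G : SimpleGraph V)
    [DecidableRel G.Adj] (b c : ℕ → ℕ) : Prop :=
  G.Connected ∧
  ∀ x y : V,
    ((G.neighborFinset y).filter (fun z => G.dist x z = G.dist x y - 1)).card
        = c (G.dist x y) ∧
    ((G.neighborFinset y).filter (fun z => G.dist x z = G.dist x y + 1)).card
        = b (G.dist x y)

namespace IsDRG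

variable {V : Type*} [Fintype V] [DecidableEq V] {G : SimpleGraph V} [DecidableRel G.Adj]
  {b c : ℕ → ℕ}

lemma dist_cases_of_adj (h : IsDRG G b c) (x : V) {y z : V} (hyz : G.Adj y z) :
    G.dist x z = G.dist x y - 1 ∨ G.dist x z = G.dist x y ∨ G.dist x z = G.dist x y + 1 := by
  have h1 := h.1.dist_triangle (u := x) (v := y) (w := z)
  have h2 := h.1.dist_triangle (u := x) (v := z) (w := y)
  rw [dist_eq_one_iff_adj.mpr hyz] at h1
  rw [dist_eq_one_iff_adj.mpr hyz.symm] at h2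
  omega

lemma card_neighborFinset (h : IsDRG G b c) (x : V) : (G.neighborFinset x).card = b 0 := by
  have h0 := (h.2 x x).2
  rw [dist_self, zero_add, filter_true_of_mem] at h0
  · exact h0
  · intro z hz
    exact dist_eq_one_iff_adj.mpr ((G.mem_neighborFinset x z).mp hz)

lemma sum_neighborFinset {R : Type*} [CommRing R] (h : IsDRG G b c) (w : ℕ → R) (x y : V) :
    ∑ z ∈ G.neighborFinset y, w (G.dist x z) =
      c (G.dist x y) * w (G.dist x y - 1) +
      ((b 0 : R) - c (G.dist x y) - b (G.dist x y)) * w (G.dist x y) +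
      b (G.dist x y) * w (G.dist x y + 1) := by
  have key : ∀ z ∈ G.neighborFinset y, w (G.dist x z) = w (G.dist x y) +
      (if G.dist x z = G.dist x y - 1 then w (G.dist x y - 1) - w (G.dist x y) else 0) +
      (if G.dist x z = G.dist x y + 1 then w (G.dist x y + 1) - w (G.dist x y) else 0) := by
    intro z hz
    have hc := h.dist_cases_of_adj x ((G.mem_neighborFinset y z).mp hz)
    split_ifs with h1 h2 h2
    · omega
    · rw [h1]; ring
    · rw [h2]; ring
    · rw [show G.dist x z = G.dist x y by omega]; ring
  rw [sum_congr rfl key, sum_add_distrib, sum_add_distrib, ← sum_filter, ← sum_filter]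
  simp only [sum_const, nsmul_eq_mul, (h.2 x y).1, (h.2 x y).2, h.card_neighborFinset]
  ring

lemma card_common_neighbors_of_adj (h : IsDRG G b c) {x y : V} (hxy : G.Adj x y) :
    ((G.neighborFinset x ∩ G.neighborFinset y).card : ℤ) = (b 0 : ℤ) - c 1 - b 1 := by
  have hs := h.sum_neighborFinset (fun i => if i = 1 then (1 : ℤ) else 0) x y
  rw [dist_eq_one_iff_adj.mpr hxy] at hs
  simp only [← sum_filter, dist_eq_one_iff_adj] at hs
  have : G.neighborFinset x ∩ G.neighborFinset y = {z ∈ G.neighborFinset y | G.Adj x z} := by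
    ext z; simp [and_comm]
  rw [this]
  simpa using hs

lemma card_common_neighbors_of_not_adj (h : IsDRG G b c) {v x y : V} (hx : G.Adj v x)
    (hy : G.Adj v y) (hne : x ≠ y) (hxy : ¬ G.Adj x y) :
    (G.neighborFinset x ∩ G.neighborFinset y).card = c 2 := by
  have hd : G.dist x y = 2 := by
    have h1 := h.1.dist_triangle (u := x) (v := v) (w := y)
    rw [dist_eq_one_iff_adj.mpr hx.symm, dist_eq_one_iff_adj.mpr hy] at h1
    have h2 := h.1.pos_dist_of_ne hne
    have h3 : G.dist x y ≠ 1 := fun h => hxy (dist_eq_one_iff_adj.mp h)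
    omega
  have hs := (h.2 x y).1
  rw [hd] at hs
  rw [← hs]
  congr 1
  ext z; simp [and_comm]

end IsDRG

section DistMatrix

variable {V : Type*} [Fintype V] [DecidableEq V]

/-- The matrix whose entry at `(x, y)` is `w` evaluated at the distance of `x` and `y`. -/
noncomputable def distMatrix (G : SimpleGraph V) (w : ℕ → ℤ) : Matrix V V ℤ :=
  Matrix.of fun x y => w (G.dist x y)

/-- The Delsarte argument: a symmetric matrix that is constant `p` on the diagonal and
constant `q` on edges, and whose square is a positive multiple of itself, bounds cliques. -/
lemma isClique_card_bound {G : SimpleGraph V} {w : ℕ → ℤ} {l : ℤ} (hl : 0 < l)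
    (hw : distMatrix G w * distMatrix G w = l • distMatrix G w) {s : Finset V}
    (hs : G.IsClique s) : 0 ≤ s.card * (w 0 + (s.card - 1) * w 1) := by
  have h1 : ∑ x ∈ s, ∑ y ∈ s, (distMatrix G w * distMatrix G w) x y =
      ∑ z, (∑ x ∈ s, w (G.dist x z)) ^ 2 := by
    simp only [sq, sum_mul_sum, Matrix.mul_apply]
    rw [sum_comm]
    simp only [sum_comm (s := s) (t := univ)]
    refine sum_congr rfl fun z _ => ?_
    rw [sum_comm]
    simp [distMatrix, dist_comm]
  have h2 : ∀ x ∈ s, ∑ y ∈ s, distMatrix G w x y = w 0 + (s.card - 1) * w 1 := by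
    intro x hx
    rw [← add_sum_erase s _ hx, sum_congr rfl (g := fun _ => w 1)]
    · rw [sum_const, card_erase_of_mem hx, nsmul_eq_mul, Nat.cast_pred (card_pos.mpr ⟨x, hx⟩)]
      simp [distMatrix]
    · intro y hy
      have : G.dist x y = 1 := dist_eq_one_iff_adj.mpr
        (hs hx (mem_of_mem_erase hy) (ne_of_mem_erase hy).symm)
      simp [distMatrix, this]
  have h3 : 0 ≤ l * (s.card * (w 0 + (s.card - 1) * w 1)) := by
    have h4 : ∑ x ∈ s, ∑ y ∈ s, (distMatrix G w * distMatrix G w) x y =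
        l * (s.card * (w 0 + (s.card - 1) * w 1)) := by
      simp only [hw, Matrix.smul_apply, smul_eq_mul, ← mul_sum]
      rw [sum_congr rfl h2, sum_const, nsmul_eq_mul]
    rw [← h4, h1]
    positivity
  exact nonneg_of_mul_nonneg_right h3 hl

/-- In a graph of valency `55` with `a₁ = 18` and `c₂ = 4`, every local graph has no coclique of
size `4`, which forces a large clique. -/
lemma exists_isClique_card_ge {G : SimpleGraph V} [DecidableRel G.Adj] (v : V)
    (hdeg : (G.neighborFinset v).card = 55)
    (hadj : ∀ x y, G.Adj x y → (G.neighborFinset x ∩ G.neighborFinset y).card = 18)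
    (hnadj : ∀ x y, G.Adj v x → G.Adj v y → x ≠ y → ¬ G.Adj x y →
      (G.neighborFinset x ∩ G.neighborFinset y).card = 4) :
    ∃ s : Finset V, G.IsClique s ∧ 17 ≤ s.card := by
  let B : V → Finset V := fun x => insert x (G.neighborFinset v ∩ G.neighborFinset x)
  have hB : ∀ x, G.Adj v x → (B x).card = 19 := by
    intro x hx
    rw [card_insert_of_notMem (by simp), hadj v x hx]
  have hBsub : ∀ x, G.Adj v x → B x ⊆ G.neighborFinset v := by
    intro x hx
    exact insert_subset (by simpa using hx) inter_subset_left
  have hBB : ∀ x y, G.Adj v x → G.Adj v y → y ∉ B x → (B x ∩ B y).card ≤ 3 := by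
    intro x y hx hy hxy
    have hne : x ≠ y := by rintro rfl; simp [B] at hxy
    have hxy' : ¬ G.Adj x y := by simp_all [B]
    have hv : v ∈ G.neighborFinset x ∩ G.neighborFinset y := by
      simp [hx.symm, hy.symm]
    have hsub : B x ∩ B y ⊆ (G.neighborFinset x ∩ G.neighborFinset y).erase v := by
      intro z hz
      have hyx' : ¬ G.Adj y x := fun h => hxy' h.symm
      simp only [B, mem_inter, mem_insert, mem_neighborFinset, mem_erase] at hz ⊢
      rcases hz with ⟨rfl | h1, rfl | h2⟩
      · exact absurd rfl hne
      · exact absurd h2.2 hyx'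
      · exact absurd h1.2 hxy'
      · exact ⟨h1.1.ne', h1.2, h2.2⟩
    have := card_le_card hsub
    rw [card_erase_of_mem hv, hnadj x y hx hy hne hxy'] at this
    omega
  obtain ⟨x, hx⟩ : ∃ x, x ∈ G.neighborFinset v := card_pos.mp (by omega)
  have hvx := (G.mem_neighborFinset v x).mp hx
  obtain ⟨y, hy, hyx⟩ : ∃ y ∈ G.neighborFinset v, y ∉ B x :=
    exists_mem_notMem_of_card_lt_card (by rw [hB x hvx]; omega)
  have hvy := (G.mem_neighborFinset v y).mp hy
  refine ⟨G.neighborFinset v \ (B x ∪ B y), ?_, ?_⟩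
  · intro z hz u hu hzu
    by_contra hnzu
    simp only [coe_sdiff, Set.mem_sdiff, mem_coe, mem_union, not_or] at hz hu
    have hvz := (G.mem_neighborFinset v z).mp hz.1
    have hvu := (G.mem_neighborFinset v u).mp hu.1
    have huz : u ∉ B z := by
      simp [B, hzu.symm, hnzu]
    have e1 := card_union_add_card_inter (B x) (B y)
    have e2 := card_union_add_card_inter (B x ∪ B y) (B z)
    have e3 := card_union_add_card_inter (B x ∪ B y ∪ B z) (B u)
    have f2 := card_union_le (B x ∩ B z) (B y ∩ B z)
    have f3 := card_union_le (B x ∩ B u ∪ B y ∩ B u) (B z ∩ B u)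
    have f4 := card_union_le (B x ∩ B u) (B y ∩ B u)
    rw [← union_inter_distrib_right] at f2
    rw [← union_inter_distrib_right, ← union_inter_distrib_right] at f3
    rw [← union_inter_distrib_right] at f4
    have hle : (B x ∪ B y ∪ B z ∪ B u).card ≤ (G.neighborFinset v).card :=
      card_le_card (union_subset (union_subset (union_subset (hBsub x hvx) (hBsub y hvy))
        (hBsub z hvz)) (hBsub u hvu))
    have := hBB x y hvx hvy hyx
    have := hBB x z hvx hvz hz.2.1
    have := hBB y z hvy hvz hz.2.2
    have := hBB x u hvx hvu hu.2.1
    have := hBB y u hvy hvu hu.2.2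
    have := hBB z u hvz hvu huz
    have := hB x hvx
    have := hB y hvy
    have := hB z hvz
    have := hB u hvu
    omega
  · have h1 := le_card_sdiff (B x ∪ B y) (G.neighborFinset v)
    have h2 := card_union_le (B x) (B y)
    rw [hB x hvx, hB y hvy] at h2
    omega

/-- The values `33, -3, 1, -3` of the scaled cosine sequence of the eigenvalue `-5`. -/
def cosineSeq (i : ℕ) : ℤ :=
  if i = 0 then 33 else if i = 2 then 1 else -3

lemma distMatrix_cosineSeq_mul_self {G : SimpleGraph V} {R : (ℕ → ℤ) → ℕ → ℤ}
    (h3 : ∀ x y : V, G.dist x y ≤ 3) {A : Matrix V V ℤ}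
    (hA : A = distMatrix G (fun i => if i = 1 then 1 else 0))
    (h1 : distMatrix G (fun i => if i = 0 then 1 else 0) = 1)
    (hmul : ∀ w, distMatrix G w * A = distMatrix G (R w))
    (hR0 : ∀ w, R w 0 = 55 * w 1) (hR1 : ∀ w, R w 1 = w 0 + 18 * w 1 + 36 * w 2)
    (hR2 : ∀ w, R w 2 = 4 * w 1 + 40 * w 2 + 11 * w 3)
    (hR3 : ∀ w, R w 3 = 45 * w 2 + 10 * w 3) :
    distMatrix G cosineSeq * distMatrix G cosineSeq = (96 : ℤ) • distMatrix G cosineSeq := by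
  set E := distMatrix G cosineSeq with hE
  set D := distMatrix G (fun i => if i = 2 then 1 else 0) with hD
  set F := distMatrix G (fun i => if i = 3 then 1 else 0) with hF
  have hEA : E * A = (-5 : ℤ) • E := by
    rw [hmul]
    ext x y
    have := h3 x y
    simp only [hE, distMatrix, Matrix.of_apply, Matrix.smul_apply, smul_eq_mul]
    interval_cases G.dist x y <;> simp [hR0, hR1, hR2, hR3, cosineSeq]
  have hAA : A * A = (55 : ℤ) • 1 + (18 : ℤ) • A + (4 : ℤ) • D := by
    nth_rw 1 [hA]
    rw [hmul, hA, ← h1]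
    ext x y
    have := h3 x y
    simp only [hD, distMatrix, Matrix.of_apply, Matrix.smul_apply, smul_eq_mul, Matrix.add_apply]
    interval_cases G.dist x y <;> simp [hR0, hR1, hR2, hR3]
  have hDA : D * A = (36 : ℤ) • A + (40 : ℤ) • D + (45 : ℤ) • F := by
    rw [hmul, hA]
    ext x y
    have := h3 x y
    simp only [hD, hF, distMatrix, Matrix.of_apply, Matrix.smul_apply, smul_eq_mul,
      Matrix.add_apply]
    interval_cases G.dist x y <;> simp [hR0, hR1, hR2, hR3]
  have hEexp : E = (33 : ℤ) • 1 + (-3 : ℤ) • A + D + (-3 : ℤ) • F := by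
    rw [hA, ← h1]
    ext x y
    have := h3 x y
    simp only [hE, hD, hF, distMatrix, Matrix.of_apply, Matrix.smul_apply, smul_eq_mul,
      Matrix.add_apply]
    interval_cases G.dist x y <;> simp [cosineSeq]
  have hED : E * D = (15 : ℤ) • E := by
    have h := congrArg (E * ·) hAA
    simp only [← mul_assoc, hEA, mul_add, Matrix.mul_smul, mul_one, Matrix.smul_mul] at h
    ext x y
    have := congrFun (congrFun h x) y
    simp only [Matrix.smul_apply, smul_eq_mul, Matrix.add_apply] at this ⊢
    linarith
  have hEF : E * F = (-11 : ℤ) • E := by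
    have h := congrArg (E * ·) hDA
    simp only [← mul_assoc, hED, hEA, mul_add, Matrix.mul_smul, Matrix.smul_mul] at h
    ext x y
    have := congrFun (congrFun h x) y
    simp only [Matrix.smul_apply, smul_eq_mul, Matrix.add_apply] at this ⊢
    linarith
  nth_rw 2 [hEexp]
  simp only [mul_add, Matrix.mul_smul, hEA, hED, hEF, mul_one]
  module

end DistMatrix

/-- There is no distance-regular graph with intersection array
`{55, 36, 11; 1, 4, 45}` (diameter `3`). -/
theorem no_drg_55_36_11 {V : Type*} [Fintype V] [DecidableEq V]
    (G : SimpleGraph V) [DecidableRel G.Adj] :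
    ¬ (IsDRG G
        (fun i => if i = 0 then 55 else if i = 1 then 36 else if i = 2 then 11 else 0)
        (fun i => if i = 1 then 1 else if i = 2 then 4 else if i = 3 then 45 else 0) ∧
      (∀ x y : V, G.dist x y ≤ 3) ∧ (∃ x y : V, G.dist x y = 3)) := by
  rintro ⟨h, h3, v, -, -⟩
  obtain ⟨s, hs, hcard⟩ := exists_isClique_card_ge (G := G) v
    (by simpa using h.card_neighborFinset v)
    (fun x y hxy => by
      have := h.card_common_neighbors_of_adj hxy
      norm_num at this
      exact_mod_cast this)
    (fun x y hx hy hne hxy => by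
      simpa using h.card_common_neighbors_of_not_adj hx hy hne hxy)
  have hsq := distMatrix_cosineSeq_mul_self (G := G) h3 (A := G.adjMatrix ℤ)
    (R := fun w d =>
      ((if d = 1 then 1 else if d = 2 then 4 else if d = 3 then 45 else 0 : ℕ) : ℤ) * w (d - 1) +
      (55 - ((if d = 1 then 1 else if d = 2 then 4 else if d = 3 then 45 else 0 : ℕ) : ℤ) -
        ((if d = 0 then 55 else if d = 1 then 36 else if d = 2 then 11 else 0 : ℕ) : ℤ)) * w d +
      ((if d = 0 then 55 else if d = 1 then 36 else if d = 2 then 11 else 0 : ℕ) : ℤ) * w (d + 1))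
    (by ext x y; simp [distMatrix, adjMatrix_apply, dist_eq_one_iff_adj])
    (by ext x y; simp [distMatrix, Matrix.one_apply, h.1.dist_eq_zero_iff])
    (fun w => by
      ext x y
      have := h.sum_neighborFinset w x y
      rw [mul_adjMatrix_apply]
      exact this)
    (fun w => by simp) (fun w => by simp) (fun w => by simp) (fun w => by simp)
  have hb := isClique_card_bound (by norm_num) hsq hs
  simp only [cosineSeq] at hb
  norm_num at hb
  have : (17 : ℤ) ≤ s.card := by exact_mod_cast hcard
  nlinarith
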